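/- Let m ∈ (0,1), T > 0 and κ > 0. The time-shifted Barenblatt function Ū(t,x) := 𝒰(t+κ, x) solves, in the sense of distributions, ∂_t u = ∂²_{xx}(u^m) on [0, T−κ] with initial condition u(0,·) = 𝒰(κ,·): for every φ ∈ C_c^∞(ℝ) and every t ∈ [0, T−κ], ∫_ℝ φ(x) 𝒰(t+κ, x) dx = ∫_ℝ φ(x) 𝒰(κ, x) dx + ∫₀ᵗ ∫_ℝ 𝒰(s+κ, x)^m φ''(x) dx ds. -/

import Mathlib

open MeasureTheory Real Set

/-- The constant k̃ = (1-m)/(2(m+1)m). -/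
noncomputable def ktilde (m : ℝ) : ℝ := (1 - m) / (2 * (m + 1) * m)

/-- The constant I = ∫_{-π/2}^{π/2} (cos x)^{2m/(1-m)} dx. -/
noncomputable def Iconst (m : ℝ) : ℝ := ∫ x in (-(π/2))..(π/2), Real.cos x ^ (2*m/(1-m))

/-- The constant D = (I/√k̃)^{2(1-m)/(m+1)}. -/
noncomputable def Dconst (m : ℝ) : ℝ := (Iconst m / Real.sqrt (ktilde m)) ^ (2*(1-m)/(m+1))

/-- The Barenblatt function 𝒰(t,x) = t^{-α}(D + k̃ x² t^{-2α})^{-1/(1-m)}, α = 1/(m+1). -/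
noncomputable def barenblatt (m t x : ℝ) : ℝ :=
  t ^ (-(1/(m+1))) * (Dconst m + ktilde m * x^2 * t ^ (-(2*(1/(m+1))))) ^ (-(1/(1-m)))

lemma ktilde_pos {m : ℝ} (hm : m ∈ Ioo (0:ℝ) 1) : 0 < ktilde m := by
  obtain ⟨h0, h1⟩ := hm
  have : 0 < 1 - m := by linarith
  unfold ktilde
  positivity

lemma Iconst_pos {m : ℝ} (hm : m ∈ Ioo (0:ℝ) 1) : 0 < Iconst m := by
  obtain ⟨h0, h1⟩ := hm
  have h1' : 0 < 1 - m := by linarith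
  refine intervalIntegral.intervalIntegral_pos_of_pos_on ?_ ?_ (by linarith [Real.pi_pos])
  · refine (Continuous.rpow_const Real.continuous_cos fun x => Or.inr ?_).intervalIntegrable _ _
    positivity
  · exact fun x hx => Real.rpow_pos_of_pos (Real.cos_pos_of_mem_Ioo hx) _

lemma Dconst_pos {m : ℝ} (hm : m ∈ Ioo (0:ℝ) 1) : 0 < Dconst m :=
  Real.rpow_pos_of_pos (div_pos (Iconst_pos hm) (Real.sqrt_pos.2 (ktilde_pos hm))) _

/-- The denominator D + k̃ x² t^{-2α} of the Barenblatt profile. -/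
noncomputable def barenblattDenom (m t x : ℝ) : ℝ :=
  Dconst m + ktilde m * x^2 * t ^ (-(2*(1/(m+1))))

/-- The spatial derivative of the Barenblatt function. -/
noncomputable def barenblattDx (m t x : ℝ) : ℝ :=
  -(2 * ktilde m / (1 - m)) * x * t ^ (-(2*(1/(m+1)))) / barenblattDenom m t x * barenblatt m t x

lemma barenblatt_eq (m t x : ℝ) :
    barenblatt m t x = t ^ (-(1/(m+1))) * barenblattDenom m t x ^ (-(1/(1-m))) := rfl

lemma barenblattDenom_pos {m t : ℝ} (hm : m ∈ Ioo (0:ℝ) 1) (ht : 0 < t) (x : ℝ) :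
    0 < barenblattDenom m t x := by
  have := Dconst_pos hm
  have := ktilde_pos hm
  unfold barenblattDenom
  positivity

lemma barenblatt_pos {m t : ℝ} (hm : m ∈ Ioo (0:ℝ) 1) (ht : 0 < t) (x : ℝ) :
    0 < barenblatt m t x :=
  mul_pos (Real.rpow_pos_of_pos ht _) (Real.rpow_pos_of_pos (barenblattDenom_pos hm ht x) _)

lemma continuousOn_barenblattDenom {m : ℝ} :
    ContinuousOn (fun p : ℝ × ℝ => barenblattDenom m p.1 p.2) {p | 0 < p.1} := by
  unfold barenblattDenom
  refine continuousOn_const.add ((by fun_prop : Continuous fun p : ℝ × ℝ =>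
    ktilde m * p.2 ^ 2).continuousOn.mul (continuousOn_fst.rpow_const fun p hp => Or.inl ?_))
  exact (show 0 < p.1 from hp).ne'

lemma continuousOn_barenblatt {m : ℝ} (hm : m ∈ Ioo (0:ℝ) 1) :
    ContinuousOn (fun p : ℝ × ℝ => barenblatt m p.1 p.2) {p | 0 < p.1} := by
  refine (continuousOn_fst.rpow_const fun p hp => Or.inl ?_).mul
    (continuousOn_barenblattDenom.rpow_const fun p hp => Or.inl ?_)
  · exact (show 0 < p.1 from hp).ne'
  · exact (barenblattDenom_pos hm hp p.2).ne'

lemma continuousOn_barenblattDx {m : ℝ} (hm : m ∈ Ioo (0:ℝ) 1) :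
    ContinuousOn (fun p : ℝ × ℝ => barenblattDx m p.1 p.2) {p | 0 < p.1} := by
  refine ContinuousOn.mul (ContinuousOn.div ((continuousOn_const.mul continuousOn_snd).mul
    (continuousOn_fst.rpow_const fun p hp => Or.inl ?_)) continuousOn_barenblattDenom
      fun p hp => ?_) (continuousOn_barenblatt hm)
  · exact (show 0 < p.1 from hp).ne'
  · exact (barenblattDenom_pos hm hp p.2).ne'

lemma hasDerivAt_barenblatt_space {m t : ℝ} (hm : m ∈ Ioo (0:ℝ) 1) (ht : 0 < t) (x : ℝ) :
    HasDerivAt (barenblatt m t) (barenblattDx m t x) x := by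
  have hV := barenblattDenom_pos hm ht x
  have h1 : 1 - m ≠ 0 := by linarith [hm.2]
  have hd : HasDerivAt (barenblattDenom m t)
      (2 * ktilde m * x * t ^ (-(2*(1/(m+1))))) x := by
    refine ((((hasDerivAt_pow 2 x).const_mul (ktilde m)).mul_const
      (t ^ (-(2*(1/(m+1)))))).const_add (Dconst m)).congr_deriv ?_
    push_cast
    ring
  refine ((hd.rpow_const (p := -(1/(1-m))) (Or.inl hV.ne')).const_mul
    (t ^ (-(1/(m+1))))).congr_deriv ?_
  rw [Real.rpow_sub_one hV.ne', barenblattDx, barenblatt_eq]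
  field_simp

lemma hasDerivAt_barenblatt_time {m t : ℝ} (hm : m ∈ Ioo (0:ℝ) 1) (ht : 0 < t) (x : ℝ) :
    HasDerivAt (fun s => barenblatt m s x)
      (-(1/(m+1)) / t * (barenblatt m t x + x * barenblattDx m t x)) t := by
  have hV := barenblattDenom_pos hm ht x
  have h1 : 1 - m ≠ 0 := by linarith [hm.2]
  have h2 : m + 1 ≠ 0 := by linarith [hm.1]
  have hr (q : ℝ) : HasDerivAt (fun s : ℝ => s ^ q) (q * (t ^ q / t)) t := by
    rw [← Real.rpow_sub_one ht.ne']
    exact Real.hasDerivAt_rpow_const (Or.inl ht.ne')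
  have hd : HasDerivAt (fun s => barenblattDenom m s x) _ t :=
    ((hr (-(2*(1/(m+1))))).const_mul (ktilde m * x ^ 2)).const_add (Dconst m)
  refine ((hr (-(1/(m+1)))).mul
    (hd.rpow_const (p := -(1/(1-m))) (Or.inl hV.ne'))).congr_deriv ?_
  rw [Real.rpow_sub_one hV.ne', barenblattDx, barenblatt_eq]
  field_simp
  ring

lemma hasDerivAt_barenblatt_rpow {m t : ℝ} (hm : m ∈ Ioo (0:ℝ) 1) (ht : 0 < t) (x : ℝ) :
    HasDerivAt (fun y => barenblatt m t y ^ m)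
      (-(1/(m+1)) / t * (x * barenblatt m t x)) x := by
  have hV := barenblattDenom_pos hm ht x
  have h0 : m ≠ 0 := hm.1.ne'
  have h1 : 1 - m ≠ 0 := by linarith [hm.2]
  have h2 : m + 1 ≠ 0 := by linarith [hm.1]
  refine ((hasDerivAt_barenblatt_space hm ht x).rpow_const (p := m)
    (Or.inl (barenblatt_pos hm ht x).ne')).congr_deriv (Eq.symm ?_)
  have hp : barenblatt m t x ^ (m - 1) =
      t ^ (-(1/(m+1)) * (m - 1)) * barenblattDenom m t x := by
    rw [barenblatt_eq, Real.mul_rpow (by positivity) (by positivity), ← Real.rpow_mul ht.le,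
      ← Real.rpow_mul hV.le]
    congr 1
    rw [show -(1/(1-m)) * (m - 1) = 1 by field_simp; ring, Real.rpow_one]
  have ht' : t ^ (-(2*(1/(m+1)))) * t ^ (-(1/(m+1)) * (m - 1)) = t⁻¹ := by
    rw [← Real.rpow_add ht, ← Real.rpow_neg_one]
    congr 1
    field_simp
    ring
  have hk : 2 * ktilde m / (1 - m) * m = 1 / (m + 1) := by
    unfold ktilde
    field_simp
  calc -(1/(m+1)) / t * (x * barenblatt m t x)
      = -(2 * ktilde m / (1 - m) * m) * x * barenblatt m t x *
        (t ^ (-(2*(1/(m+1)))) * t ^ (-(1/(m+1)) * (m - 1))) := by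
          rw [hk, ht']; ring
    _ = _ := by
      rw [hp, barenblattDx]
      field_simp

/-- The time derivative of the Barenblatt function. -/
noncomputable def barenblattDt (m t x : ℝ) : ℝ :=
  -(1/(m+1)) / t * (barenblatt m t x + x * barenblattDx m t x)

lemma continuousOn_barenblattDt {m : ℝ} (hm : m ∈ Ioo (0:ℝ) 1) :
    ContinuousOn (fun p : ℝ × ℝ => barenblattDt m p.1 p.2) {p | 0 < p.1} := by
  refine (continuousOn_const.div continuousOn_fst fun p hp => ?_).mul
    ((continuousOn_barenblatt hm).add (continuousOn_snd.mul (continuousOn_barenblattDx hm)))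
  exact (show 0 < p.1 from hp).ne'

/-- Integrating by parts twice against a compactly supported test function. -/
lemma integral_mul_deriv_deriv_eq {w w' w'' φ : ℝ → ℝ} (hw : ∀ x, HasDerivAt w (w' x) x)
    (hw' : ∀ x, HasDerivAt w' (w'' x) x) (hw'' : Continuous w'')
    (hφ : ContDiff ℝ 2 φ) (hφsupp : HasCompactSupport φ) :
    ∫ x, w x * deriv (deriv φ) x = ∫ x, φ x * w'' x := by
  have hcw : Continuous w := continuous_iff_continuousAt.2 fun x => (hw x).continuousAt
  have hcw' : Continuous w' := continuous_iff_continuousAt.2 fun x => (hw' x).continuousAt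
  have hφ1 : ContDiff ℝ 1 (deriv φ) := hφ.deriv'
  have hs1 : HasCompactSupport (deriv φ) := hφsupp.deriv
  have hs2 : HasCompactSupport (deriv (deriv φ)) := hs1.deriv
  have hc2 : Continuous (deriv (deriv φ)) := hφ1.continuous_deriv le_rfl
  have int {f g : ℝ → ℝ} (hf : Continuous f) (hg : Continuous g) (hs : HasCompactSupport g) :
      Integrable (f * g) := (hf.mul hg).integrable_of_hasCompactSupport hs.mul_left
  rw [integral_mul_deriv_eq_deriv_mul_of_integrable (fun x _ => hw x)
      (fun x _ => (hφ1.differentiable one_ne_zero x).hasDerivAt) (int hcw hc2 hs2)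
      (int hcw' hφ1.continuous hs1) (int hcw hφ1.continuous hs1),
    integral_mul_deriv_eq_deriv_mul_of_integrable (fun x _ => hw' x)
      (fun x _ => (hφ.differentiable two_ne_zero x).hasDerivAt) (int hcw' hφ1.continuous hs1)
      (int hw'' hφ.continuous hφsupp) (int hcw' hφ.continuous hφsupp), neg_neg]
  simp_rw [mul_comm]

/-- A continuous function on a strip with support in a fixed compact set of the second variable
satisfies Fubini's theorem. -/
lemma integral_intervalIntegral_swap {f : ℝ → ℝ → ℝ} {t : ℝ} (ht : 0 ≤ t) {K : Set ℝ}
    (hK : IsCompact K) (hf : ContinuousOn f.uncurry (Icc 0 t ×ˢ univ))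
    (hfK : ∀ s, ∀ x ∉ K, f s x = 0) :
    ∫ x, ∫ s in (0:ℝ)..t, f s x = ∫ s in (0:ℝ)..t, ∫ x, f s x := by
  simp_rw [intervalIntegral.integral_of_le ht, ← integral_Icc_eq_integral_Ioc]
  refine (integral_integral_swap ?_).symm
  have hi : IntegrableOn f.uncurry (Icc 0 t ×ˢ univ) (volume.prod volume) := by
    refine IntegrableOn.of_forall_sdiff_eq_zero (s := Icc 0 t ×ˢ K) ?_
      (measurableSet_Icc.prod MeasurableSet.univ) fun p hp => hfK _ _ fun h => hp.2 ⟨hp.1.1, h⟩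
    exact (hf.mono (prod_mono_right (subset_univ _))).integrableOn_compact
      (isCompact_Icc.prod hK)
  rwa [IntegrableOn, ← Measure.prod_restrict, Measure.restrict_univ] at hi

lemma integral_barenblatt_rpow_mul {m t : ℝ} (hm : m ∈ Ioo (0:ℝ) 1) (ht : 0 < t) {φ : ℝ → ℝ}
    (hφ : ContDiff ℝ 2 φ) (hφsupp : HasCompactSupport φ) :
    ∫ x, barenblatt m t x ^ m * deriv (deriv φ) x = ∫ x, φ x * barenblattDt m t x := by
  refine integral_mul_deriv_deriv_eq (hasDerivAt_barenblatt_rpow hm ht) (fun x => ?_) ?_ hφ hφsupp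
  · refine (((hasDerivAt_id x).mul (hasDerivAt_barenblatt_space hm ht x)).const_mul
      (-(1/(m+1)) / t)).congr_deriv ?_
    simp [barenblattDt]
  · exact (continuousOn_barenblattDt hm).comp_continuous (f := fun x => (t, x)) (by fun_prop)
      fun x => ht

/-- the time-shifted Barenblatt function Ū(t,x) = 𝒰(t+κ,x) solves
∂_t u = ∂²_{xx}(u^m) on [0,T-κ] in the sense of distributions with initial
condition u(0,·) = 𝒰(κ,·). -/
theorem shifted_barenblatt_distributional_solution
    (m : ℝ) (hm : m ∈ Set.Ioo (0:ℝ) 1) (T κ : ℝ) (hκ : 0 < κ) (hκT : κ < T)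
    (φ : ℝ → ℝ) (hφ : ContDiff ℝ (⊤ : ℕ∞) φ) (hφsupp : HasCompactSupport φ) :
    ∀ t ∈ Set.Icc (0:ℝ) (T - κ),
      ∫ x, φ x * barenblatt m (t + κ) x
        = (∫ x, φ x * barenblatt m κ x)
          + ∫ s in (0:ℝ)..t, ∫ x, barenblatt m (s + κ) x ^ m * deriv (deriv φ) x := by
  rintro t ⟨ht, -⟩
  have hpos : ∀ s ∈ Icc 0 t, 0 < s + κ := fun s hs => by linarith [hs.1]
  have hφ2 : ContDiff ℝ 2 φ := contDiff_infty.1 hφ 2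
  have hint (s : ℝ) (hs : 0 < s) : Integrable fun x => φ x * barenblatt m s x :=
    (hφ.continuous.mul ((continuousOn_barenblatt hm).comp_continuous (f := fun x => (s, x))
      (by fun_prop) fun x => hs)).integrable_of_hasCompactSupport hφsupp.mul_right
  have hcont : ContinuousOn (fun p : ℝ × ℝ => φ p.2 * barenblattDt m (p.1 + κ) p.2)
      (Icc 0 t ×ˢ univ) :=
    (hφ.continuous.comp continuous_snd).continuousOn.mul
      ((continuousOn_barenblattDt hm).comp (f := fun p : ℝ × ℝ => (p.1 + κ, p.2))
        (by fun_prop) fun p hp => hpos p.1 hp.1)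
  have hftc (x : ℝ) : ∫ s in (0:ℝ)..t, φ x * barenblattDt m (s + κ) x =
      φ x * barenblatt m (t + κ) x - φ x * barenblatt m κ x := by
    rw [intervalIntegral.integral_eq_sub_of_hasDerivAt
      (f := fun s => φ x * barenblatt m (s + κ) x), zero_add]
    · intro s hs
      rw [uIcc_of_le ht] at hs
      exact ((hasDerivAt_barenblatt_time hm (hpos s hs) x).comp_add_const s κ).const_mul (φ x)
    · refine ContinuousOn.intervalIntegrable ?_
      rw [uIcc_of_le ht]
      exact hcont.comp (f := fun s => (s, x)) (by fun_prop) fun s hs => ⟨hs, mem_univ _⟩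
  have hswap := integral_intervalIntegral_swap (f := fun s x => φ x * barenblattDt m (s + κ) x)
    ht hφsupp.isCompact hcont fun s x hx => by simp [image_eq_zero_of_notMem_tsupport hx]
  simp_rw [hftc] at hswap
  rw [integral_sub (hint _ (hpos t ⟨ht, le_rfl⟩)) (hint _ hκ)] at hswap
  have hrhs : ∫ s in (0:ℝ)..t, ∫ x, barenblatt m (s + κ) x ^ m * deriv (deriv φ) x =
      ∫ s in (0:ℝ)..t, ∫ x, φ x * barenblattDt m (s + κ) x := by
    refine intervalIntegral.integral_congr fun s hs => ?_
    rw [uIcc_of_le ht] at hs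
    exact integral_barenblatt_rpow_mul hm (hpos s hs) hφ2 hφsupp
  rw [hrhs, ← hswap]
  ring
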